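/- arXiv:1612.07641 — 2 statements merged into one kernel-verified Lean document; each statement's English description precedes it below -/
import Mathlib

section
/- Let 1 ≤ n ≤ d and let J = (j_1,…,j_{2n}) be a list with entries in {1,…,d} such that every value j occurring in J occurs an even number m_j of times. Then the integral over the orthogonal group of the one-row monomial satisfies ∫_{O(d)} g_{1,j_1} g_{1,j_2} ⋯ g_{1,j_{2n}} dg = (∏_j (m_j − 1)!!) · ∫_{O(d)} g_{1,1}^2 g_{1,2}^2 ⋯ g_{1,n}^2 dg, where the product is over the distinct values j occurring in J and (2k−1)!! = 1·3·5⋯(2k−1). -/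
open MeasureTheory Nat

noncomputable instance (d : ℕ) : MeasurableSpace (Matrix.orthogonalGroup (Fin d) ℝ) :=
  borel _

instance oBorel (d : ℕ) : BorelSpace (Matrix.orthogonalGroup (Fin d) ℝ) := ⟨rfl⟩

instance oCompact (d : ℕ) : CompactSpace (Matrix.orthogonalGroup (Fin d) ℝ) := by
  refine (isCompact_iff_compactSpace (s := (Matrix.orthogonalGroup (Fin d) ℝ : Set (Matrix (Fin d) (Fin d) ℝ)))).mp ?_
  have hc : IsCompact (Set.pi Set.univ fun _ : Fin d => Set.pi Set.univ fun _ : Fin d =>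
      Set.Icc (-1 : ℝ) 1) := isCompact_univ_pi fun _ => isCompact_univ_pi fun _ => isCompact_Icc
  refine IsCompact.of_isClosed_subset hc ?_ ?_
  · exact isClosed_unitary (R := Matrix (Fin d) (Fin d) ℝ)
  · intro U hU i _ j _
    have := entry_norm_bound_of_unitary (𝕜 := ℝ) hU i j
    exact abs_le.mp this

theorem o_right {d : ℕ} (μ : Measure (Matrix.orthogonalGroup (Fin d) ℝ)) [μ.IsHaarMeasure]
    [IsProbabilityMeasure μ] : μ.IsMulRightInvariant := by
  refine ⟨fun g => ?_⟩
  haveI : IsProbabilityMeasure (μ.map (· * g)) :=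
    Measure.isProbabilityMeasure_map (by fun_prop)
  exact Measure.isHaarMeasure_eq_of_isProbabilityMeasure _ _

theorem rot_mem {d : ℕ} {i j : Fin d} (hij : i ≠ j) (θ : ℝ) :
    (1 + (Real.cos θ - 1) • (Matrix.single i i (1:ℝ) + Matrix.single j j 1)
      + Real.sin θ • (Matrix.single j i (1:ℝ) - Matrix.single i j 1)) ∈
      Matrix.orthogonalGroup (Fin d) ℝ := by
  rw [Matrix.mem_orthogonalGroup_iff']
  have hji := hij.symm
  set P : Matrix (Fin d) (Fin d) ℝ := Matrix.single i i (1:ℝ) + Matrix.single j j 1 with hP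
  set Q : Matrix (Fin d) (Fin d) ℝ := Matrix.single j i (1:ℝ) - Matrix.single i j 1 with hQ
  have hPP : P * P = P := by
    simp [hP, add_mul, mul_add, hij, hji]
  have hPQ : P * Q = Q := by
    simp [hP, hQ, add_mul, mul_sub, hij, hji]; try abel
  have hQP : Q * P = Q := by
    simp [hP, hQ, sub_mul, mul_add, hij, hji]; try abel
  have hQQ : Q * Q = -P := by
    simp [hP, hQ, sub_mul, mul_sub, hij, hji]; try abel
  have hPt : P.transpose = P := by simp [hP]
  have hQt : Q.transpose = -Q := by simp [hQ]
  simp only [Matrix.transpose_add, Matrix.transpose_smul, hPt, hQt, Matrix.transpose_one]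
  simp only [add_mul, mul_add, one_mul, mul_one, smul_mul_assoc, mul_smul_comm, neg_mul, hPP, hPQ,
    hQP, hQQ, smul_neg, neg_neg, smul_add]
  have h := Real.sin_sq_add_cos_sq θ
  have h2 : (Real.cos θ - 1) • P + (Real.cos θ - 1) • P + (Real.cos θ - 1) • (Real.cos θ - 1) • P
    + Real.sin θ • Real.sin θ • P = 0 := by
    simp only [smul_smul, ← add_smul]
    rw [show Real.cos θ - 1 + (Real.cos θ - 1) + (Real.cos θ - 1) * (Real.cos θ - 1)
      + Real.sin θ * Real.sin θ = 0 by linarith [h]]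
    simp
  have h3 : (Real.cos θ - 1) • Real.sin θ • Q = Real.sin θ • (Real.cos θ - 1) • Q := smul_comm _ _ _
  rw [h3]
  calc _ = 1 + ((Real.cos θ - 1) • P + (Real.cos θ - 1) • P +
        (Real.cos θ - 1) • (Real.cos θ - 1) • P + Real.sin θ • Real.sin θ • P) := by abel
    _ = 1 := by rw [h2, add_zero]

/-- rotation -/
noncomputable def rot {d : ℕ} {i j : Fin d} (hij : i ≠ j) (θ : ℝ) :
    Matrix.orthogonalGroup (Fin d) ℝ := ⟨_, rot_mem hij θ⟩

theorem rot_i {d : ℕ} {i j : Fin d} (hij : i ≠ j) (θ : ℝ) (g : Matrix.orthogonalGroup (Fin d) ℝ)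
    (r : Fin d) : (g * rot hij θ).1 r i = Real.cos θ * g.1 r i + Real.sin θ * g.1 r j := by
  have hji := hij.symm
  simp [rot, mul_add, mul_sub, hij, hji]
  try ring

theorem rot_j {d : ℕ} {i j : Fin d} (hij : i ≠ j) (θ : ℝ) (g : Matrix.orthogonalGroup (Fin d) ℝ)
    (r : Fin d) : (g * rot hij θ).1 r j = - Real.sin θ * g.1 r i + Real.cos θ * g.1 r j := by
  have hji := hij.symm
  simp [rot, mul_add, mul_sub, hij, hji]
  try ring

theorem rot_k {d : ℕ} {i j : Fin d} (hij : i ≠ j) (θ : ℝ) (g : Matrix.orthogonalGroup (Fin d) ℝ)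
    (r k : Fin d) (hi : k ≠ i) (hj : k ≠ j) : (g * rot hij θ).1 r k = g.1 r k := by
  simp [rot, mul_add, mul_sub, hi, hj]

theorem o_int {d : ℕ} (μ : Measure (Matrix.orthogonalGroup (Fin d) ℝ))
    [IsProbabilityMeasure μ] {f : Matrix.orthogonalGroup (Fin d) ℝ → ℝ} (hf : Continuous f) :
    Integrable f μ :=
  hf.integrable_of_hasCompactSupport (HasCompactSupport.of_compactSpace f)

theorem o_cont {d : ℕ} (r k : Fin d) :
    Continuous fun g : Matrix.orthogonalGroup (Fin d) ℝ => g.1 r k :=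
  continuous_subtype_val.matrix_elem r k

/-- rotated monomial -/
noncomputable def FF (p q : ℕ) (θ x y m : ℝ) : ℝ :=
  (Real.cos θ * x + Real.sin θ * y) ^ (2 * p + 1) *
    (- Real.sin θ * x + Real.cos θ * y) ^ (2 * q + 1) * m

/-- its derivative -/
noncomputable def FD (p q : ℕ) (θ x y m : ℝ) : ℝ :=
  (((2 * p + 1 : ℕ) * (Real.cos θ * x + Real.sin θ * y) ^ (2 * p) *
      (- Real.sin θ * x + Real.cos θ * y)) *
    (- Real.sin θ * x + Real.cos θ * y) ^ (2 * q + 1) +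
    (Real.cos θ * x + Real.sin θ * y) ^ (2 * p + 1) *
    ((2 * q + 1 : ℕ) * (- Real.sin θ * x + Real.cos θ * y) ^ (2 * q) *
     (- Real.cos θ * x + - Real.sin θ * y))) * m

theorem FF_deriv (p q : ℕ) (θ x y m : ℝ) :
    HasDerivAt (fun θ => FF p q θ x y m) (FD p q θ x y m) θ := by
  have h1 : HasDerivAt (fun θ => Real.cos θ * x + Real.sin θ * y)
    (- Real.sin θ * x + Real.cos θ * y) θ :=
    ((Real.hasDerivAt_cos θ).mul_const _).add ((Real.hasDerivAt_sin θ).mul_const _)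
  have h2 : HasDerivAt (fun θ => - Real.sin θ * x + Real.cos θ * y)
    (- Real.cos θ * x + - Real.sin θ * y) θ :=
    ((Real.hasDerivAt_sin θ).neg.mul_const _).add ((Real.hasDerivAt_cos θ).mul_const _)
  have h3 := ((h1.fun_pow (2 * p + 1)).fun_mul (h2.fun_pow (2 * q + 1))).mul_const m
  rw [Nat.add_sub_cancel, Nat.add_sub_cancel] at h3
  exact h3

theorem FF_cont {X : Type*} [TopologicalSpace X] (p q : ℕ) {t x y m : X → ℝ} (ht : Continuous t)
    (hx : Continuous x) (hy : Continuous y) (hm : Continuous m) :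
    Continuous fun g => FF p q (t g) (x g) (y g) (m g) := by
  unfold FF; fun_prop

theorem FD_cont {X : Type*} [TopologicalSpace X] (p q : ℕ) {t x y m : X → ℝ} (ht : Continuous t)
    (hx : Continuous x) (hy : Continuous y) (hm : Continuous m) :
    Continuous fun g => FD p q (t g) (x g) (y g) (m g) := by
  unfold FD; fun_prop

theorem FD_zero (p q : ℕ) (x y m : ℝ) : FD p q 0 x y m =
    (2 * p + 1) * (x ^ (2 * p) * y ^ (2 * q + 2) * m) -
      (2 * q + 1) * (x ^ (2 * p + 2) * y ^ (2 * q) * m) := by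
  simp [FD]
  ring

theorem key {d : ℕ} (μ : Measure (Matrix.orthogonalGroup (Fin d) ℝ)) [μ.IsHaarMeasure]
    [IsProbabilityMeasure μ] {i j : Fin d} (hij : i ≠ j) (p q : ℕ)
    (x y : Matrix.orthogonalGroup (Fin d) ℝ → ℝ) (ci : Continuous x) (cj : Continuous y)
    (hx : ∀ g θ, x (g * rot hij θ) = Real.cos θ * x g + Real.sin θ * y g)
    (hy : ∀ g θ, y (g * rot hij θ) = - Real.sin θ * x g + Real.cos θ * y g)
    (m : Matrix.orthogonalGroup (Fin d) ℝ → ℝ) (hm : Continuous m)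
    (hinv : ∀ g θ, m (g * rot hij θ) = m g) :
    (2 * q + 1) * ∫ g, x g ^ (2 * p + 2) * y g ^ (2 * q) * m g ∂μ =
    (2 * p + 1) * ∫ g, x g ^ (2 * p) * y g ^ (2 * q + 2) * m g ∂μ := by
  have := o_right μ
  have hF : ∀ θ, ∫ g, FF p q θ (x g) (y g) (m g) ∂μ = ∫ g, FF p q 0 (x g) (y g) (m g) ∂μ := by
    intro θ
    rw [← integral_mul_right_eq_self (fun g => FF p q 0 (x g) (y g) (m g)) (rot hij θ)]
    congr 1
    ext g
    simp only [FF, hx, hy, hinv]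
    simp
  have cF : ∀ θ, Continuous (fun g => FF p q θ (x g) (y g) (m g)) := fun θ =>
    FF_cont p q continuous_const ci cj hm
  have cD : ∀ θ, Continuous (fun g => FD p q θ (x g) (y g) (m g)) := fun θ =>
    FD_cont p q continuous_const ci cj hm
  have cF' : Continuous (fun z : ℝ × Matrix.orthogonalGroup (Fin d) ℝ =>
      FD p q z.1 (x z.2) (y z.2) (m z.2)) :=
    FD_cont p q continuous_fst (ci.comp continuous_snd) (cj.comp continuous_snd)
      (hm.comp continuous_snd)
  obtain ⟨C, hC⟩ := ((isCompact_Icc (a := (-1:ℝ)) (b := 1)).prod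
    (isCompact_univ (X := Matrix.orthogonalGroup (Fin d) ℝ))).exists_bound_of_continuousOn
    cF'.continuousOn
  have hD := (hasDerivAt_integral_of_dominated_loc_of_deriv_le (μ := μ)
    (F := fun θ g => FF p q θ (x g) (y g) (m g)) (F' := fun θ g => FD p q θ (x g) (y g) (m g))
    (x₀ := 0) (s := Set.Icc (-1) 1) (bound := fun _ => C)
    (Icc_mem_nhds (by norm_num) (by norm_num))
    (Filter.Eventually.of_forall fun θ => (o_int μ (cF θ)).1) (o_int μ (cF 0))
    (o_int μ (cD 0)).1
    (Filter.Eventually.of_forall fun g θ hθ => hC (θ, g) ⟨hθ, trivial⟩)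
    (integrable_const C)
    (Filter.Eventually.of_forall fun g θ hθ => FF_deriv p q θ _ _ _)).2
  have h0 : ∫ g, FD p q 0 (x g) (y g) (m g) ∂μ = 0 := by
    refine hD.unique ?_
    simp_rw [hF]
    exact hasDerivAt_const _ _
  simp_rw [FD_zero] at h0
  rw [integral_sub (o_int μ (by fun_prop)) (o_int μ (by fun_prop)), integral_const_mul,
    integral_const_mul] at h0
  linarith

/-- normalized moment -/
noncomputable def nm {d : ℕ} (μ : Measure (Matrix.orthogonalGroup (Fin d) ℝ)) (r : Fin d)
    (s : Multiset (Fin d)) : ℝ :=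
  (∫ g, ∏ k, g.1 r k ^ (2 * s.count k) ∂μ) / ∏ k, ((2 * s.count k - 1)‼ : ℝ)

theorem nm_swap {d : ℕ} (μ : Measure (Matrix.orthogonalGroup (Fin d) ℝ)) [μ.IsHaarMeasure]
    [IsProbabilityMeasure μ] (r : Fin d) (i j : Fin d) (s : Multiset (Fin d)) :
    nm μ r (i ::ₘ s) = nm μ r (j ::ₘ s) := by
  rcases eq_or_ne i j with rfl | hij
  · rfl
  have hji := hij.symm
  have split : ∀ f : Fin d → ℝ, ∏ k, f k = f i * f j * ∏ k ∈ (Finset.univ.erase i).erase j, f k := by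
    intro f
    rw [← Finset.mul_prod_erase _ _ (Finset.mem_univ i),
      ← Finset.mul_prod_erase (Finset.univ.erase i) _ (a := j) (by simp [hji]), mul_assoc]
  have hdf : ∀ n : ℕ, ((2 * (n + 1) - 1)‼ : ℝ) = (2 * n + 1) * ((2 * n - 1)‼ : ℝ) := by
    intro n
    rcases n with _ | n
    · simp
    · rw [show 2 * (n + 1 + 1) - 1 = (2 * n + 1) + 2 by omega, Nat.doubleFactorial_add_two,
        show 2 * (n + 1) - 1 = 2 * n + 1 by omega]
      push_cast; ring
  have hpos : ∀ n : ℕ, ((n‼ : ℕ) : ℝ) ≠ 0 := fun n => by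
    exact_mod_cast (Nat.doubleFactorial_pos n).ne'
  have K := key μ hij (s.count i) (s.count j)
    (fun g => g.1 r i) (fun g => g.1 r j) (o_cont r i) (o_cont r j)
    (fun g θ => rot_i hij θ g r) (fun g θ => rot_j hij θ g r)
    (fun g => ∏ k ∈ (Finset.univ.erase i).erase j, g.1 r k ^ (2 * s.count k))
    (continuous_finsetProd _ fun k _ => (o_cont r k).pow _)
    (fun g θ => Finset.prod_congr rfl fun k hk => by
      simp only [Finset.mem_erase] at hk
      rw [rot_k hij θ g r k hk.2.1 hk.1])
  have e1 : ∀ g : Matrix.orthogonalGroup (Fin d) ℝ,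
      ∏ k, g.1 r k ^ (2 * (i ::ₘ s).count k) = g.1 r i ^ (2 * s.count i + 2) *
      g.1 r j ^ (2 * s.count j) * ∏ k ∈ (Finset.univ.erase i).erase j, g.1 r k ^ (2 * s.count k) := by
    intro g
    rw [split, Multiset.count_cons_self, Multiset.count_cons_of_ne hji]
    congr 1
    exact Finset.prod_congr rfl fun k hk => by
      simp only [Finset.mem_erase] at hk
      rw [Multiset.count_cons_of_ne hk.2.1]
  have e2 : ∀ g : Matrix.orthogonalGroup (Fin d) ℝ,
      ∏ k, g.1 r k ^ (2 * (j ::ₘ s).count k) = g.1 r i ^ (2 * s.count i) *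
      g.1 r j ^ (2 * s.count j + 2) *
        ∏ k ∈ (Finset.univ.erase i).erase j, g.1 r k ^ (2 * s.count k) := by
    intro g
    rw [split, Multiset.count_cons_self, Multiset.count_cons_of_ne hij]
    congr 1
    exact Finset.prod_congr rfl fun k hk => by
      simp only [Finset.mem_erase] at hk
      rw [Multiset.count_cons_of_ne hk.1]
  have d1 : ∏ k, ((2 * (i ::ₘ s).count k - 1)‼ : ℝ) =
      (2 * s.count i + 1) * ∏ k, ((2 * s.count k - 1)‼ : ℝ) := by
    rw [split, split, Multiset.count_cons_self, Multiset.count_cons_of_ne hji, hdf]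
    rw [mul_assoc, mul_assoc, mul_assoc]
    congr 3
    exact Finset.prod_congr rfl fun k hk => by
      simp only [Finset.mem_erase] at hk
      rw [Multiset.count_cons_of_ne hk.2.1]
  have d2 : ∏ k, ((2 * (j ::ₘ s).count k - 1)‼ : ℝ) =
      (2 * s.count j + 1) * ∏ k, ((2 * s.count k - 1)‼ : ℝ) := by
    rw [split, split, Multiset.count_cons_self, Multiset.count_cons_of_ne hij, hdf]
    have : ∏ k ∈ (Finset.univ.erase i).erase j, ((2 * (j ::ₘ s).count k - 1)‼ : ℝ) =
      ∏ k ∈ (Finset.univ.erase i).erase j, ((2 * s.count k - 1)‼ : ℝ) :=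
      Finset.prod_congr rfl fun k hk => by
        simp only [Finset.mem_erase] at hk
        rw [Multiset.count_cons_of_ne hk.1]
    rw [this]; ring
  have hP : ∏ k, ((2 * s.count k - 1)‼ : ℝ) ≠ 0 := Finset.prod_ne_zero_iff.mpr fun k _ => hpos _
  have h1 : (2 * (s.count i : ℝ) + 1) ≠ 0 := by positivity
  have h2 : (2 * (s.count j : ℝ) + 1) ≠ 0 := by positivity
  unfold nm
  rw [d1, d2]
  simp_rw [e1, e2]
  rw [div_eq_div_iff (mul_ne_zero h1 hP) (mul_ne_zero h2 hP)]
  linear_combination (∏ k, ((2 * s.count k - 1)‼ : ℝ)) * K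

theorem nm_rep {d : ℕ} (μ : Measure (Matrix.orthogonalGroup (Fin d) ℝ)) [μ.IsHaarMeasure]
    [IsProbabilityMeasure μ] (r i : Fin d) (s : Multiset (Fin d)) : ∀ u : Multiset (Fin d),
    nm μ r (s + u) = nm μ r (Multiset.replicate s.card i + u) := by
  induction s using Multiset.induction with
  | empty => intro u; simp
  | cons a s ih =>
    intro u
    rw [Multiset.cons_add, nm_swap μ r a i, ← Multiset.add_cons, ih, Multiset.card_cons,
      Multiset.replicate_succ, Multiset.cons_add, Multiset.add_cons]

theorem nm_eq {d : ℕ} (μ : Measure (Matrix.orthogonalGroup (Fin d) ℝ)) [μ.IsHaarMeasure]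
    [IsProbabilityMeasure μ] (r : Fin d) (s t : Multiset (Fin d)) (h : s.card = t.card) :
    nm μ r s = nm μ r t := by
  have h1 := nm_rep μ r r s 0
  have h2 := nm_rep μ r r t 0
  rw [add_zero] at h1 h2
  rw [h1, h2, h]

/-- One-row monomials over the orthogonal group: if 1 ≤ n ≤ d and every value j occurring
in the list J = (j₁,…,j_{2n}) (entries in {1,…,d}) occurs an even number m_j of times,
then ∫_{O(d)} g_{1,j₁}⋯g_{1,j_{2n}} dg = (∏_j (m_j − 1)!!) · ∫_{O(d)} g_{1,1}²⋯g_{1,n}² dg,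
the product over the distinct values occurring in J. -/
theorem stmt5 (d n : ℕ) (hn : 1 ≤ n) (hnd : n ≤ d)
    (J : Fin (2*n) → Fin d)
    (hJ : ∀ j : Fin d, Even ((Finset.univ.filter fun k => J k = j).card))
    (μ : Measure (Matrix.orthogonalGroup (Fin d) ℝ)) [μ.IsHaarMeasure]
    [IsProbabilityMeasure μ] :
    ∫ g, ∏ k : Fin (2*n), (g : Matrix (Fin d) (Fin d) ℝ) ⟨0, by omega⟩ (J k) ∂μ =
      (∏ j ∈ Finset.univ.image J,
          (((Finset.univ.filter fun k => J k = j).card - 1)‼ : ℝ)) *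
        ∫ g, ∏ k : Fin n,
          ((g : Matrix (Fin d) (Fin d) ℝ) ⟨0, by omega⟩ (Fin.castLE hnd k)) ^ 2 ∂μ := by
  set r : Fin d := ⟨0, by omega⟩ with hr
  choose p hp using fun j => (hJ j).two_dvd
  let s : Multiset (Fin d) := ∑ j, Multiset.replicate (p j) j
  let t : Multiset (Fin d) := Finset.univ.val.map (Fin.castLE hnd)
  have hs : ∀ j, s.count j = p j := by
    intro j
    simp [s, Multiset.count_sum', Multiset.count_replicate]
  have hcard : s.card = t.card := by
    have h1 : ∑ j, (Finset.univ.filter fun k => J k = j).card = 2 * n := by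
      rw [← Finset.card_eq_sum_card_fiberwise (f := J) (s := Finset.univ) (t := Finset.univ)
        (fun _ _ => by simp)]
      simp
    have h2 : s.card = ∑ j, p j := by simp [s]
    simp_rw [hp] at h1
    rw [← Finset.mul_sum] at h1
    simp only [t, Multiset.card_map, Finset.card_val, Finset.card_univ, Fintype.card_fin]
    omega
  have ht : ∀ j, t.count j ≤ 1 := by
    refine Multiset.nodup_iff_count_le_one.mp ?_
    exact Finset.univ.nodup.map (Fin.castLE_injective hnd)
  have e := nm_eq μ r s t hcard
  have ht1 : ∏ k, ((2 * t.count k - 1)‼ : ℝ) = 1 := by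
    refine Finset.prod_eq_one fun k _ => ?_
    have := ht k
    interval_cases t.count k <;> simp
  have I1 : ∀ g : Matrix.orthogonalGroup (Fin d) ℝ,
      ∏ k : Fin (2*n), g.1 r (J k) = ∏ k, g.1 r k ^ (2 * s.count k) := by
    intro g
    rw [← Finset.prod_fiberwise_of_maps_to (s := Finset.univ) (t := Finset.univ) (g := J)
      (fun _ _ => Finset.mem_univ _)]
    refine Finset.prod_congr rfl fun j _ => ?_
    rw [hs, ← hp, ← Finset.prod_const]
    exact Finset.prod_congr rfl fun k hk => by rw [(Finset.mem_filter.mp hk).2]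
  have I2 : ∀ g : Matrix.orthogonalGroup (Fin d) ℝ,
      ∏ k : Fin n, g.1 r (Fin.castLE hnd k) ^ 2 = ∏ k, g.1 r k ^ (2 * t.count k) := by
    intro g
    have : ∏ k : Fin n, g.1 r (Fin.castLE hnd k) ^ 2 = (t.map fun k => g.1 r k ^ 2).prod := by
      simp only [t, Finset.prod, Multiset.map_map]; rfl
    rw [this, Finset.prod_multiset_map_count]
    simp_rw [pow_mul]
    refine Finset.prod_subset (Finset.subset_univ _) fun k _ hk => ?_
    rw [Multiset.count_eq_zero_of_notMem (by simpa using hk), pow_zero]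
  have D : ∏ j ∈ Finset.univ.image J,
      (((Finset.univ.filter fun k => J k = j).card - 1)‼ : ℝ) =
      ∏ k, ((2 * s.count k - 1)‼ : ℝ) := by
    simp_rw [hs, ← hp]
    refine Finset.prod_subset (Finset.subset_univ _) fun k _ hk => ?_
    have : (Finset.univ.filter fun l => J l = k) = ∅ := by
      refine Finset.filter_eq_empty_iff.mpr fun l _ h => hk ?_
      rw [← h]; exact Finset.mem_image_of_mem _ (Finset.mem_univ _)
    rw [this]; simp
  have hP : ∏ k, ((2 * s.count k - 1)‼ : ℝ) ≠ 0 := Finset.prod_ne_zero_iff.mpr fun k _ => by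
    exact_mod_cast (Nat.doubleFactorial_pos _).ne'
  unfold nm at e
  rw [ht1, div_one, div_eq_iff hP] at e
  rw [D]
  simp_rw [I1, I2]
  rw [e, mul_comm]
end

section
/- Let d ≥ n ≥ 1 and let I, I', J, J' be lists of length n with entries in {1,…,d}. Then there exist finitely many pairs of lists (I^{(1)}, I'^{(1)}), …, (I^{(r)}, I'^{(r)}) such that each I^{(k)} and each I'^{(k)} is a list of length n in which every value of {1,…,n} occurs exactly once, and ∫_{U(d)} ∏_{m=1}^n g_{i_m j_m} ∏_{m=1}^n ḡ_{i'_m j'_m} dg = Σ_{k=1}^{r} ∫_{U(d)} ∏_{m=1}^n g_{I^{(k)}_m, j_m} ∏_{m=1}^n ḡ_{I'^{(k)}_m, j'_m} dg. -/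
open MeasureTheory Finset

noncomputable instance (d : ℕ) : MeasurableSpace (Matrix.unitaryGroup (Fin d) ℂ) :=
  borel _

/-- A list of length n with entries in {1,…,d} in which every value of {1,…,n} occurs
exactly once. -/
def IsFullList {d n : ℕ} (L : Fin n → Fin d) : Prop :=
  Function.Injective L ∧ ∀ m, (L m).val < n

def tp {d : ℕ} (n : ℕ) (M : Matrix (Fin d) (Fin d) ℂ) :
    Matrix (Fin n → Fin d) (Fin n → Fin d) ℂ := Matrix.of fun I K => ∏ m, M (I m) (K m)

lemma tp_mul {d n : ℕ} (M N : Matrix (Fin d) (Fin d) ℂ) : tp n (M * N) = tp n M * tp n N := by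
  ext I K
  simp [tp, Matrix.mul_apply, Finset.prod_univ_sum, Finset.prod_mul_distrib]

lemma tp_conj {d n : ℕ} (M : Matrix (Fin d) (Fin d) ℂ) :
    tp n (M.conjTranspose) = (tp n M).conjTranspose := by
  ext I K
  simp [tp, Matrix.conjTranspose_apply]

lemma prod_ite_fn {d n : ℕ} (I K : Fin n → Fin d) :
    (∏ m, (if I m = K m then (1 : ℂ) else 0)) = if I = K then 1 else 0 := by
  rw [Finset.prod_ite_zero]
  simp [funext_iff]

lemma tp_diag {d n : ℕ} (D : Fin d → ℂ) :
    tp n (Matrix.diagonal D) = Matrix.diagonal (fun I => ∏ m, D (I m)) := by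
  ext I K
  simp only [tp, Matrix.of_apply, Matrix.diagonal_apply]
  rw [Finset.prod_ite_zero]
  simp [funext_iff]

lemma tp_one {d n : ℕ} : tp n (1 : Matrix (Fin d) (Fin d) ℂ) = 1 := by
  rw [← Matrix.diagonal_one, tp_diag]; simp

section comm
variable {d n : ℕ} (A : Matrix (Fin n → Fin d) (Fin n → Fin d) ℂ)
  (hA : ∀ U ∈ Matrix.unitaryGroup (Fin d) ℂ, A * tp n U = tp n U * A)

def cnt (I : Fin n → Fin d) (a : Fin d) : ℕ := #{m | I m = a}

lemma prod_cnt (D : Fin d → ℂ) (I : Fin n → Fin d) : ∏ m, D (I m) = ∏ a, D a ^ cnt I a := by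
  unfold cnt
  simp_rw [← Finset.prod_const]
  rw [Finset.prod_fiberwise']

include hA in
lemma weight (I K : Fin n → Fin d) (h : A I K ≠ 0) (a : Fin d) : cnt I a = cnt K a := by
  have hz := Complex.isPrimitiveRoot_exp (n+1) (by omega)
  set z := Complex.exp (2 * Real.pi * Complex.I / ((n + 1 : ℕ) : ℂ)) with hzd
  have hn1 : ‖z‖ = 1 := hz.norm'_eq_one (by omega)
  have hzz : star z * z = 1 := by
    have := Complex.conj_mul' z
    rw [hn1] at this
    simpa using this
  have hU : Matrix.diagonal (Function.update (1 : Fin d → ℂ) a z) ∈ Matrix.unitaryGroup (Fin d) ℂ := by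
    rw [Matrix.mem_unitaryGroup_iff', Matrix.star_eq_conjTranspose, Matrix.diagonal_conjTranspose,
      Matrix.diagonal_mul_diagonal, ← Matrix.diagonal_one]
    congr 1
    ext b
    by_cases hb : b = a
    · subst hb; simpa using hzz
    · simp [hb]
  have h1 := congrFun (congrFun (hA _ hU) I) K
  rw [tp_diag, Matrix.mul_diagonal, Matrix.diagonal_mul, mul_comm] at h1
  have h2 := mul_right_cancel₀ h h1
  have hp : ∀ L : Fin n → Fin d, ∏ m, (Function.update (1 : Fin d → ℂ) a z) (L m) = z ^ cnt L a := by
    intro L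
    rw [prod_cnt, Finset.prod_eq_single a]
    · simp
    · intro b _ hb; simp [hb]
    · simp
  rw [hp, hp] at h2
  have hb : ∀ L : Fin n → Fin d, cnt L a < n + 1 := fun L => by
    have := Finset.card_filter_le (univ : Finset (Fin n)) (fun m => L m = a)
    simp at this
    unfold cnt; omega
  exact (hz.pow_inj (hb K) (hb I) h2).symm

include hA in
lemma comm_diag (D : Fin d → ℂ) : A * tp n (Matrix.diagonal D) = tp n (Matrix.diagonal D) * A := by
  ext I K
  rw [tp_diag, Matrix.mul_diagonal, Matrix.diagonal_mul, mul_comm]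
  by_cases h : A I K = 0
  · simp [h]
  · rw [prod_cnt, prod_cnt]
    simp_rw [weight A hA I K h]

lemma comm_mul {M N : Matrix (Fin d) (Fin d) ℂ} (hM : A * tp n M = tp n M * A)
    (hN : A * tp n N = tp n N * A) : A * tp n (M * N) = tp n (M * N) * A := by
  rw [tp_mul, ← mul_assoc, hM, mul_assoc, hN, mul_assoc]

include hA in
lemma comm_herm (H : Matrix (Fin d) (Fin d) ℂ) (hH : H.IsHermitian) :
    A * tp n H = tp n H * A := by
  have := hH.spectral_theorem
  rw [Unitary.conjStarAlgAut_apply] at this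
  rw [this]
  apply comm_mul
  · apply comm_mul
    · exact hA _ hH.eigenvectorUnitary.2
    · exact comm_diag A hA _
  · exact hA _ (star hH.eigenvectorUnitary).2

include hA in
lemma comm_all (M : Matrix (Fin d) (Fin d) ℂ) : A * tp n M = tp n M * A := by
  induction M using Matrix.diagonal_transvection_induction with
  | hdiag D _ => exact comm_diag A hA D
  | hmul M N hM hN => exact comm_mul A hM hN
  | htransvec t =>
    obtain ⟨i, j, hij, c⟩ := t
    simp only [Matrix.TransvectionStruct.toMatrix_mk]
    have hS : (Matrix.swap ℂ i j).IsHermitian := by simp [Matrix.IsHermitian]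
    have h1 : A * tp n (Matrix.transvection i j (1:ℂ)) = tp n (Matrix.transvection i j (1:ℂ)) * A := by
      have : Matrix.transvection i j (1:ℂ) =
          (Matrix.swap ℂ i j + Matrix.single i i 1) * Matrix.swap ℂ i j := by
        rw [add_mul, Matrix.swap_mul_self, Matrix.transvection]
        congr 1
        ext a b
        by_cases hb : b = i
        · subst hb
          rw [Matrix.mul_swap_apply_left]
          simp [Matrix.single_apply, hij, hij.symm]
        · by_cases hb' : b = j
          · subst hb'
            rw [Matrix.mul_swap_apply_right]
            simp [Matrix.single_apply]
          · rw [Matrix.mul_swap_of_ne hb hb']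
            simp [Matrix.single_apply, Ne.symm hb, Ne.symm hb']
      rw [this]
      apply comm_mul
      · apply comm_herm A hA
        apply hS.add
        simp [Matrix.IsHermitian]
      · exact comm_herm A hA _ hS
    by_cases hc : c = 0
    · subst hc; simp [tp_one]
    have : Matrix.transvection i j c = Matrix.diagonal (Function.update (1 : Fin d → ℂ) i c) *
        Matrix.transvection i j (1:ℂ) * Matrix.diagonal (Function.update (1 : Fin d → ℂ) i c⁻¹) := by
      ext a b
      rw [Matrix.mul_diagonal, Matrix.diagonal_mul]
      simp only [Matrix.transvection, Matrix.add_apply, Matrix.single_apply, Matrix.one_apply, Function.update_apply,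
        Pi.one_apply]
      by_cases ha : a = i <;> by_cases hb : b = i <;> by_cases hb' : b = j <;> grind
    rw [this]
    exact comm_mul A (comm_mul A (comm_diag A hA _) h1) (comm_diag A hA _)

include hA in
lemma full_of_ne (hnd : n ≤ d) (K : Fin n → Fin d) (h : A K (Fin.castLE hnd) ≠ 0) :
    IsFullList K := by
  have hw := weight A hA _ _ h
  have hle : ∀ a, cnt K a ≤ 1 := by
    intro a
    rw [hw a, cnt, Finset.card_le_one]
    intro x hx y hy
    simp only [Finset.mem_filter, Finset.mem_univ, true_and] at hx hy
    exact Fin.castLE_injective hnd (hx.trans hy.symm)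
  refine ⟨?_, ?_⟩
  · intro x y hxy
    exact Finset.card_le_one.1 (hle (K y)) x (by simp [hxy]) y (by simp)
  · intro m
    have h0 : 0 < cnt K (K m) := Finset.card_pos.2 ⟨m, by simp⟩
    rw [hw] at h0
    obtain ⟨m', hm'⟩ := Finset.card_pos.1 h0
    simp only [Finset.mem_filter, Finset.mem_univ, true_and] at hm'
    rw [← hm']
    exact m'.2

include hA in
lemma key_s13 (hnd : n ≤ d) (I I' : Fin n → Fin d) :
    ∃ S : Finset (Fin n → Fin d), (∀ K ∈ S, IsFullList K) ∧
    A I I' = ∑ K ∈ S, A K (Fin.castLE hnd) := by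
  classical
  let M : Matrix (Fin d) (Fin d) ℂ := Matrix.of fun a b =>
    if h : b.val < n then (if a = I' ⟨b, h⟩ then 1 else 0) else 0
  have hM : ∀ K, tp n M I K = 0 ∨ tp n M I K = 1 := by
    intro K
    by_cases h : ∃ m, M (I m) (K m) = 0
    · obtain ⟨m, hm⟩ := h
      exact Or.inl (Finset.prod_eq_zero (Finset.mem_univ m) hm)
    · right
      change ∏ m, M (I m) (K m) = 1
      refine Finset.prod_eq_one fun m _ => ?_
      by_contra h1
      refine h ⟨m, ?_⟩
      simp only [M, Matrix.of_apply] at h1 ⊢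
      split_ifs at h1 ⊢ <;> simp_all
  have hMi : ∀ L, tp n M L (Fin.castLE hnd) = if L = I' then 1 else 0 := by
    intro L
    rw [← prod_ite_fn]
    simp [tp, M]
  have hc := congrFun (congrFun (comm_all A hA M) I) (Fin.castLE hnd)
  rw [Matrix.mul_apply, Matrix.mul_apply] at hc
  simp only [hMi, mul_ite, mul_one, mul_zero, Finset.sum_ite_eq', Finset.mem_univ, if_true] at hc
  refine ⟨Finset.univ.filter fun K => tp n M I K = 1 ∧ A K (Fin.castLE hnd) ≠ 0, ?_, ?_⟩
  · intro K hK
    exact full_of_ne A hA hnd K (Finset.mem_filter.1 hK).2.2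
  · rw [hc, Finset.sum_filter]
    refine Finset.sum_congr rfl fun K _ => ?_
    by_cases h0 : A K (Fin.castLE hnd) = 0
    · simp [h0]
    · rcases hM K with h | h <;> simp [h, h0]
end comm

theorem stmt13 (d n : ℕ) (hn : 1 ≤ n) (hnd : n ≤ d)
    (I I' J J' : Fin n → Fin d)
    (μ : Measure (Matrix.unitaryGroup (Fin d) ℂ)) [μ.IsHaarMeasure]
    [IsProbabilityMeasure μ] :
    ∃ (r : ℕ) (Ks : Fin r → (Fin n → Fin d) × (Fin n → Fin d)),
      (∀ k, IsFullList (Ks k).1 ∧ IsFullList (Ks k).2) ∧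
      ∫ g, (∏ m, (g : Matrix (Fin d) (Fin d) ℂ) (I m) (J m)) *
          ∏ m, starRingEnd ℂ ((g : Matrix (Fin d) (Fin d) ℂ) (I' m) (J' m)) ∂μ =
        ∑ k : Fin r,
          ∫ g, (∏ m, (g : Matrix (Fin d) (Fin d) ℂ) ((Ks k).1 m) (J m)) *
            ∏ m, starRingEnd ℂ ((g : Matrix (Fin d) (Fin d) ℂ) ((Ks k).2 m) (J' m)) ∂μ := by
  classical
  have : BorelSpace (Matrix.unitaryGroup (Fin d) ℂ) := ⟨rfl⟩
  let A : Matrix (Fin n → Fin d) (Fin n → Fin d) ℂ := Matrix.of fun I I' =>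
    ∫ g, (∏ m, (g : Matrix (Fin d) (Fin d) ℂ) (I m) (J m)) *
          ∏ m, starRingEnd ℂ ((g : Matrix (Fin d) (Fin d) ℂ) (I' m) (J' m)) ∂μ
  have hint : ∀ K L : Fin n → Fin d, Integrable (fun g : Matrix.unitaryGroup (Fin d) ℂ =>
      (∏ m, (g : Matrix (Fin d) (Fin d) ℂ) (K m) (J m)) *
          ∏ m, starRingEnd ℂ ((g : Matrix (Fin d) (Fin d) ℂ) (L m) (J' m))) μ := by
    intro K L
    refine Integrable.of_bound (C := 1) ?_ ?_
    · apply Continuous.aestronglyMeasurable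
      have : ∀ a b, Continuous fun g : Matrix.unitaryGroup (Fin d) ℂ =>
        (g : Matrix (Fin d) (Fin d) ℂ) a b := fun a b => 
          (continuous_subtype_val).matrix_elem a b
      have hs := Complex.continuous_conj
      exact (continuous_finsetProd _ fun m _ => this _ _).mul
        (continuous_finsetProd _ fun m _ => hs.comp (this _ _))
    · refine Filter.Eventually.of_forall fun g => ?_
      rw [norm_mul, norm_prod, norm_prod]
      have hg := entry_norm_bound_of_unitary g.2
      refine mul_le_one₀ (Finset.prod_le_one (fun _ _ => norm_nonneg _) fun _ _ => hg _ _)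
        (Finset.prod_nonneg fun _ _ => norm_nonneg _)
        (Finset.prod_le_one (fun _ _ => norm_nonneg _) fun _ _ => ?_)
      rw [RCLike.norm_conj]; exact hg _ _
  have hinv : ∀ U ∈ Matrix.unitaryGroup (Fin d) ℂ, tp n U * A * (tp n U).conjTranspose = A := by
    intro U hU
    ext K L
    have h1 := integral_mul_left_eq_self (μ := μ) (fun g : Matrix.unitaryGroup (Fin d) ℂ =>
      (∏ m, (g : Matrix (Fin d) (Fin d) ℂ) (K m) (J m)) *
          ∏ m, starRingEnd ℂ ((g : Matrix (Fin d) (Fin d) ℂ) (L m) (J' m))) ⟨U, hU⟩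
    change _ = A K L at h1
    rw [← h1]
    have h2 : ∀ g : Matrix.unitaryGroup (Fin d) ℂ, 
      (∏ m, ((⟨U, hU⟩ * g : Matrix.unitaryGroup (Fin d) ℂ) : Matrix (Fin d) (Fin d) ℂ) (K m) (J m)) *
          ∏ m, starRingEnd ℂ (((⟨U, hU⟩ * g : Matrix.unitaryGroup (Fin d) ℂ) : Matrix (Fin d) (Fin d) ℂ) (L m) (J' m))
      = ∑ L', ∑ K', tp n U K K' * star (tp n U L L') * 
        ((∏ m, (g : Matrix (Fin d) (Fin d) ℂ) (K' m) (J m)) *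
          ∏ m, starRingEnd ℂ ((g : Matrix (Fin d) (Fin d) ℂ) (L' m) (J' m))) := by
      intro g
      have e1 : ∀ (K J : Fin n → Fin d), (∏ m, ((⟨U, hU⟩ * g : Matrix.unitaryGroup (Fin d) ℂ) : Matrix (Fin d) (Fin d) ℂ) (K m) (J m)) = ∑ K', tp n U K K' * tp n g K' J := by
        intro K J
        rw [← Matrix.mul_apply, ← tp_mul]; rfl
      rw [← map_prod, e1, e1, map_sum, Finset.sum_mul_sum, Finset.sum_comm]
      refine Finset.sum_congr rfl fun L' _ => Finset.sum_congr rfl fun K' _ => ?_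
      rw [← map_prod, map_mul]
      simp only [tp, Matrix.of_apply, starRingEnd_apply]
      ring
    simp_rw [h2]
    rw [integral_finsetSum _ fun L' _ => integrable_finsetSum _ fun K' _ => (hint K' L').const_mul _]
    simp only [Matrix.mul_apply, Finset.sum_mul]
    refine Finset.sum_congr rfl fun L' _ => ?_
    rw [integral_finsetSum _ fun K' _ => (hint K' L').const_mul _]
    refine Finset.sum_congr rfl fun K' _ => ?_
    rw [integral_const_mul, Matrix.conjTranspose_apply]
    simp only [A, Matrix.of_apply]
    ring
  have hA : ∀ U ∈ Matrix.unitaryGroup (Fin d) ℂ, A * tp n U = tp n U * A := by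
    intro U hU
    have h := hinv U hU
    have h3 : (tp n U).conjTranspose * tp n U = 1 := by
      rw [← tp_conj, ← tp_mul, ← Matrix.star_eq_conjTranspose, Matrix.mem_unitaryGroup_iff'.1 hU, tp_one]
    conv_lhs => rw [← h]
    rw [mul_assoc, h3, mul_one]
  obtain ⟨S, hS, hk⟩ := key_s13 A hA hnd I I'
  refine ⟨#S, fun k => ((S.equivFin.symm k : Fin n → Fin d), Fin.castLE hnd), ?_, ?_⟩
  · intro k
    exact ⟨hS _ (S.equivFin.symm k).2, Fin.castLE_injective hnd, fun m => m.2⟩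
  · change A I I' = ∑ k, A (S.equivFin.symm k) (Fin.castLE hnd)
    rw [hk, Equiv.sum_comp S.equivFin.symm (fun K : S => A K (Fin.castLE hnd)),
      Finset.sum_coe_sort S (fun K => A K (Fin.castLE hnd))]
end
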